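/- Under two-sided Gaussian bounds and conservativeness, there exist α, c, C > 0 such that |T_t(x,y) − T_t(x,z)| ≤ C·μ(B(x,√t))^{-1}·(d(y,z)/√t)^α·exp(−c·d(x,y)²/t) whenever d(y,z) ≤ √t. -/

import Mathlib

open MeasureTheory Metric

/-- A quantitative coupling bound: two probability densities `p`, `q` sharing a common part `m`
integrate a function `g` to nearly the same value, if the oscillation of `g` is controlled by a
constant plus a weight `φ` of finite first moment. -/
theorem integral_mul_sub_integral_mul_le_of_overlap {X : Type*} [MeasurableSpace X]
    {μ : Measure X} {p q m g φ : X → ℝ} {M e K₁ K₂ b : ℝ}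
    (hp : Integrable p μ) (hq : Integrable q μ) (hm : Integrable m μ)
    (hp1 : ∫ w, p w ∂μ = 1) (hq1 : ∫ w, q w ∂μ = 1) (hme : ∫ w, m w ∂μ = e)
    (hm0 : ∀ w, 0 ≤ m w) (hmp : ∀ w, m w ≤ p w) (hmq : ∀ w, m w ≤ q w)
    (hg : Measurable g) (hgb : ∀ w, |g w| ≤ b)
    (hφ : ∀ w, 0 ≤ φ w) (hosc : ∀ w w', g w - g w' ≤ M + φ w + φ w')
    (hφp : Integrable (fun w => φ w * p w) μ) (hφq : Integrable (fun w => φ w * q w) μ)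
    (hK₁ : ∫ w, φ w * p w ∂μ ≤ K₁) (hK₂ : ∫ w, φ w * q w ∂μ ≤ K₂) :
    ∫ w, g w * p w ∂μ - ∫ w, g w * q w ∂μ ≤ M * (1 - e) + K₁ + K₂ := by
  have hne : Nonempty X := by
    by_contra h
    rw [not_nonempty_iff] at h
    simp [Measure.eq_zero_of_isEmpty μ] at hp1
  have hgi : ∀ {f : X → ℝ}, Integrable f μ → Integrable (fun w => g w * f w) μ := fun hf =>
    hf.bdd_mul hg.aestronglyMeasurable (Filter.Eventually.of_forall fun w => by
      simpa [Real.norm_eq_abs] using hgb w)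
  obtain ⟨c, hc₁, hc₂⟩ : ∃ c, (∀ w, g w - φ w ≤ M + c) ∧ ∀ w, c ≤ g w + φ w := by
    have hbdd : BddAbove (Set.range fun w => g w - φ w) := by
      refine ⟨b, ?_⟩
      rintro _ ⟨w, rfl⟩
      have := (abs_le.1 (hgb w)).2
      have := hφ w
      linarith
    refine ⟨(⨆ w, (g w - φ w)) - M, fun w => ?_, fun w => ?_⟩
    · have := le_ciSup hbdd w
      linarith
    · have : (⨆ w, (g w - φ w)) ≤ M + g w + φ w :=
        ciSup_le fun w' => by linarith [hosc w' w]
      linarith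
  have hpm : Integrable (fun w => p w - m w) μ := hp.sub hm
  have hqm : Integrable (fun w => q w - m w) μ := hq.sub hm
  have h₁ : ∫ w, g w * p w ∂μ - ∫ w, g w * m w ∂μ ≤ (M + c) * (1 - e) + K₁ := by
    calc ∫ w, g w * p w ∂μ - ∫ w, g w * m w ∂μ
        = ∫ w, (g w * p w - g w * m w) ∂μ := (integral_sub (hgi hp) (hgi hm)).symm
      _ ≤ ∫ w, ((M + c) * (p w - m w) + φ w * p w) ∂μ := by
          refine integral_mono ((hgi hp).sub (hgi hm))
            ((hpm.const_mul (M + c)).add hφp) fun w => ?_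
          have := mul_le_mul_of_nonneg_right (hc₁ w) (sub_nonneg.2 (hmp w))
          have := mul_nonneg (hφ w) (hm0 w)
          simp only
          linarith
      _ = (M + c) * (1 - e) + ∫ w, φ w * p w ∂μ := by
          rw [integral_add (hpm.const_mul (M + c)) hφp, integral_const_mul,
            integral_sub hp hm, hp1, hme]
      _ ≤ _ := by linarith
  have h₂ : c * (1 - e) - K₂ ≤ ∫ w, g w * q w ∂μ - ∫ w, g w * m w ∂μ := by
    calc c * (1 - e) - K₂ ≤ c * (1 - e) - ∫ w, φ w * q w ∂μ := by linarith
      _ = ∫ w, (c * (q w - m w) - φ w * q w) ∂μ := by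
          rw [integral_sub (hqm.const_mul c) hφq, integral_const_mul,
            integral_sub hq hm, hq1, hme]
      _ ≤ ∫ w, (g w * q w - g w * m w) ∂μ := by
          refine integral_mono ((hqm.const_mul c).sub hφq)
            ((hgi hq).sub (hgi hm)) fun w => ?_
          have := mul_le_mul_of_nonneg_right (hc₂ w) (sub_nonneg.2 (hmq w))
          have := mul_nonneg (hφ w) (hm0 w)
          simp only
          linarith
      _ = _ := integral_sub (hgi hq) (hgi hm)
  linarith

theorem measure_closedBall_two_pow_mul_le {X : Type*} [MetricSpace X] [MeasurableSpace X]
    {μ : Measure X} {D : ℝ} (hD : 0 < D)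
    (hdouble : ∀ (x : X) (r : ℝ), 0 < r →
      (μ (closedBall x (2 * r))).toReal ≤ D * (μ (closedBall x r)).toReal)
    (x : X) {r : ℝ} (hr : 0 < r) (n : ℕ) :
    (μ (closedBall x (2 ^ n * r))).toReal ≤ D ^ n * (μ (closedBall x r)).toReal := by
  induction n with
  | zero => simp
  | succ n ih =>
    have h := hdouble x (2 ^ n * r) (by positivity)
    have h' := mul_le_mul_of_nonneg_left ih hD.le
    rw [pow_succ', pow_succ', mul_assoc, mul_assoc]
    exact h.trans h'

theorem measure_closedBall_toReal_mono {X : Type*} [MetricSpace X] [MeasurableSpace X]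
    {μ : Measure X} (hvol : ∀ (x : X) (r : ℝ), 0 < r → 0 < (μ (closedBall x r)).toReal)
    {s : Set X} {x : X} {r : ℝ} (hr : 0 < r) (h : s ⊆ closedBall x r) :
    (μ s).toReal ≤ (μ (closedBall x r)).toReal :=
  ENNReal.toReal_mono (fun h => by simpa [h] using hvol x r hr) (measure_mono h)

/-- A Gaussian upper bound times the distance is dominated by the kernel at a larger time. -/
theorem exists_dist_mul_kernel_le {X : Type*} [MetricSpace X] [MeasurableSpace X]
    {μ : Measure X}
    (hvol : ∀ (x : X) (r : ℝ), 0 < r → 0 < (μ (closedBall x r)).toReal)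
    {D : ℝ} (hD : 0 < D)
    (hdouble : ∀ (x : X) (r : ℝ), 0 < r →
      (μ (closedBall x (2 * r))).toReal ≤ D * (μ (closedBall x r)).toReal)
    {T : ℝ → X → X → ℝ} {C₀ c₁ c₂ : ℝ} (hC₀ : 0 < C₀) (hc₂ : 0 < c₂) (hc₁₂ : c₂ ≤ c₁)
    (hgauss : ∀ (t : ℝ), 0 < t → ∀ x y : X,
      C₀⁻¹ / (μ (closedBall x (Real.sqrt t))).toReal *
          Real.exp (-c₁ * dist x y ^ 2 / t) ≤ T t x y ∧
      T t x y ≤ C₀ / (μ (closedBall x (Real.sqrt t))).toReal *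
          Real.exp (-c₂ * dist x y ^ 2 / t)) :
    ∃ K > (0 : ℝ), ∃ C > (0 : ℝ), ∀ R : ℝ, 0 < R → ∀ y w : X,
      dist y w * T (R ^ 2) y w ≤ C * R * T (K * R ^ 2) y w := by
  have hc₁ : 0 < c₁ := hc₂.trans_le hc₁₂
  obtain ⟨n, hn⟩ := pow_unbounded_of_one_lt (Real.sqrt (2 * c₁ / c₂)) one_lt_two
  refine ⟨2 * c₁ / c₂, by positivity, (1 + 2 / c₂) * C₀ ^ 2 * D ^ n, by positivity,
    fun R hR y w => ?_⟩
  set V := (μ (closedBall y R)).toReal with hV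
  have hVpos : 0 < V := hvol y R hR
  set ξ := dist y w / R with hξ
  have hξ0 : 0 ≤ ξ := by positivity
  have hdist : dist y w = ξ * R := by rw [hξ]; field_simp
  have hup := (hgauss (R ^ 2) (by positivity) y w).2
  have hlow := (hgauss (2 * c₁ / c₂ * R ^ 2) (by positivity) y w).1
  rw [Real.sqrt_sq hR.le, ← hV, hdist,
    show -c₂ * (ξ * R) ^ 2 / R ^ 2 = -(c₂ * ξ ^ 2 / 2) + -(c₂ * ξ ^ 2 / 2) by field_simp; ring,
    Real.exp_add] at hup
  rw [Real.sqrt_mul (by positivity), Real.sqrt_sq hR.le, hdist,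
    show -c₁ * (ξ * R) ^ 2 / (2 * c₁ / c₂ * R ^ 2) = -(c₂ * ξ ^ 2 / 2) by field_simp] at hlow
  set W := (μ (closedBall y (Real.sqrt (2 * c₁ / c₂) * R))).toReal
  set E := Real.exp (-(c₂ * ξ ^ 2 / 2)) with hE
  have hEpos : 0 < E := Real.exp_pos _
  have hWpos : 0 < W := hvol y _ (by positivity)
  have hWV : W ≤ D ^ n * V :=
    (measure_closedBall_toReal_mono hvol (by positivity)
      (closedBall_subset_closedBall (by gcongr))).trans
      (measure_closedBall_two_pow_mul_le hD hdouble y hR n)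
  have hξE : ξ * E ≤ 1 + 2 / c₂ := by
    have h1 : (1 + c₂ * ξ ^ 2 / 2) * E ≤ 1 := by
      have := Real.add_one_le_exp (c₂ * ξ ^ 2 / 2)
      calc (1 + c₂ * ξ ^ 2 / 2) * E ≤ Real.exp (c₂ * ξ ^ 2 / 2) * E := by gcongr; linarith
        _ = 1 := by rw [hE, ← Real.exp_add]; simp
    have h2 : ξ ≤ (1 + 2 / c₂) * (1 + c₂ * ξ ^ 2 / 2) := by
      have : (1 + 2 / c₂) * (1 + c₂ * ξ ^ 2 / 2)
          = 1 + ξ ^ 2 + 2 / c₂ + c₂ * ξ ^ 2 / 2 := by field_simp; ring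
      rw [this]
      have : 0 ≤ 2 / c₂ + c₂ * ξ ^ 2 / 2 := by positivity
      nlinarith [sq_nonneg (ξ - 1)]
    calc ξ * E ≤ (1 + 2 / c₂) * (1 + c₂ * ξ ^ 2 / 2) * E := by gcongr
      _ = (1 + 2 / c₂) * ((1 + c₂ * ξ ^ 2 / 2) * E) := by ring
      _ ≤ (1 + 2 / c₂) * 1 := by gcongr
      _ = _ := mul_one _
  rw [hdist]
  calc ξ * R * T (R ^ 2) y w ≤ ξ * R * (C₀ / V * (E * E)) := by gcongr
    _ = (ξ * E) * (R * C₀ / V * E) := by ring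
    _ ≤ (1 + 2 / c₂) * (R * C₀ / V * E) := by gcongr
    _ = (1 + 2 / c₂) * C₀ ^ 2 * D ^ n * R * (C₀⁻¹ / (D ^ n * V) * E) := by field_simp
    _ ≤ (1 + 2 / c₂) * C₀ ^ 2 * D ^ n * R * (C₀⁻¹ / W * E) := by gcongr
    _ ≤ _ := by gcongr

/-- The Gaussian lower bound at nearby points, on a common ball. -/
theorem exists_kernel_lower_bound {X : Type*} [MetricSpace X] [MeasurableSpace X]
    {μ : Measure X}
    (hvol : ∀ (x : X) (r : ℝ), 0 < r → 0 < (μ (closedBall x r)).toReal)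
    {D : ℝ} (hD : 0 < D)
    (hdouble : ∀ (x : X) (r : ℝ), 0 < r →
      (μ (closedBall x (2 * r))).toReal ≤ D * (μ (closedBall x r)).toReal)
    {T : ℝ → X → X → ℝ} {C₀ c₁ : ℝ} (hC₀ : 0 < C₀) (hc₁ : 0 < c₁)
    (hlow : ∀ (t : ℝ), 0 < t → ∀ x y : X,
      C₀⁻¹ / (μ (closedBall x (Real.sqrt t))).toReal *
          Real.exp (-c₁ * dist x y ^ 2 / t) ≤ T t x y) :
    ∃ e > (0 : ℝ), e < 1 ∧ ∀ R : ℝ, 0 < R → ∀ y z w : X, dist y z ≤ R → dist w y ≤ R →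
      e / (μ (closedBall y R)).toReal ≤ T (R ^ 2) z w := by
  refine ⟨min (1 / 2) (C₀⁻¹ / D * Real.exp (-(4 * c₁))), by positivity,
    (min_le_left _ _).trans_lt (by norm_num), fun R hR y z w hyz hwy => ?_⟩
  have h := hlow (R ^ 2) (by positivity) z w
  rw [Real.sqrt_sq hR.le] at h
  have hVy := hvol y R hR
  have hVz := hvol z R hR
  have hV : (μ (closedBall z R)).toReal ≤ D * (μ (closedBall y R)).toReal :=
    (measure_closedBall_toReal_mono hvol (by positivity)
      (closedBall_subset_closedBall' (by rw [dist_comm z y]; linarith))).trans (hdouble y R hR)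
  have hd : dist z w ≤ 2 * R := by
    have := dist_triangle z y w
    rw [dist_comm z y, dist_comm y w] at this
    linarith
  have hexp : -(4 * c₁) ≤ -c₁ * dist z w ^ 2 / R ^ 2 := by
    rw [le_div_iff₀ (by positivity)]
    have : dist z w ^ 2 ≤ (2 * R) ^ 2 := by gcongr
    nlinarith
  calc _ ≤ (C₀⁻¹ / D * Real.exp (-(4 * c₁))) / (μ (closedBall y R)).toReal := by
        gcongr
        exact min_le_right _ _
    _ = C₀⁻¹ / (D * (μ (closedBall y R)).toReal) * Real.exp (-(4 * c₁)) := by field_simp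
    _ ≤ C₀⁻¹ / (μ (closedBall z R)).toReal * Real.exp (-c₁ * dist z w ^ 2 / R ^ 2) := by
        gcongr
    _ ≤ _ := h

/-- One smoothing step: a Markov kernel with bounded normalised first moment and
overlap at scale `R` contracts oscillations at scale `R` and controls those at larger scales. -/
theorem integral_mul_sub_integral_mul_le_of_scale {X : Type*} [MetricSpace X]
    [MeasurableSpace X] [BorelSpace X] {μ : Measure X}
    {p : X → X → ℝ} {R V e C M κ b : ℝ} (hR : 0 < R) (hV : 0 < V) (he : 0 ≤ e)
    (hκ : 0 ≤ κ) (hM : 0 ≤ M)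
    (hp0 : ∀ y w, 0 ≤ p y w) (hpi : ∀ y, Integrable (p y) μ) (hp1 : ∀ y, ∫ w, p y w ∂μ = 1)
    (hmoment_int : ∀ y, Integrable (fun w => dist y w * p y w) μ)
    (hmoment : ∀ y, ∫ w, dist y w * p y w ∂μ ≤ C * R)
    {g : X → ℝ} (hg : Measurable g) (hgb : ∀ w, |g w| ≤ b)
    (hosc : ∀ w w', |g w - g w'| ≤ M * (1 + κ * (dist w w' / R)))
    {y z : X} (hVy : (μ (closedBall y R)).toReal = V)
    (hlow : ∀ z', dist y z' ≤ R → ∀ w, dist w y ≤ R → e / V ≤ p z' w) :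
    ∫ w, g w * p y w ∂μ - ∫ w, g w * p z w ∂μ ≤
      M * ((if dist y z ≤ R then 1 - e else 1) + κ * (2 * C + dist y z / R)) := by
  have hoscφ : ∀ w w', g w - g w' ≤ M + M * κ / R * dist y w + M * κ / R * dist y w' := by
    intro w w'
    have h1 := (le_abs_self _).trans (hosc w w')
    have h2 : dist w w' ≤ dist y w + dist y w' := by
      have := dist_triangle w y w'
      rwa [dist_comm w y] at this
    have h3 : M * κ / R * dist w w' ≤ M * κ / R * (dist y w + dist y w') := by gcongr
    calc g w - g w' ≤ M + M * κ / R * dist w w' := h1.trans_eq (by ring)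
      _ ≤ _ := by linarith
  have hint : ∀ w, dist y w * p z w ≤ dist z w * p z w + dist y z * p z w := fun w => by
    have := mul_le_mul_of_nonneg_right (dist_triangle y z w) (hp0 z w)
    linarith
  have hyz_int : Integrable (fun w => dist y w * p z w) μ := by
    refine ((hmoment_int z).add ((hpi z).const_mul (dist y z))).mono'
      ((Continuous.measurable (by fun_prop)).aestronglyMeasurable.mul
        (hpi z).aestronglyMeasurable) (Filter.Eventually.of_forall fun w => ?_)
    rw [Real.norm_of_nonneg (mul_nonneg dist_nonneg (hp0 z w))]
    exact hint w
  have hyz : ∫ w, dist y w * p z w ∂μ ≤ C * R + dist y z := by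
    calc _ ≤ ∫ w, (dist z w * p z w + dist y z * p z w) ∂μ :=
          integral_mono hyz_int ((hmoment_int z).add ((hpi z).const_mul _)) hint
      _ = ∫ w, dist z w * p z w ∂μ + dist y z := by
          rw [integral_add (hmoment_int z) ((hpi z).const_mul _), integral_const_mul, hp1, mul_one]
      _ ≤ _ := by linarith [hmoment z]
  have key : ∀ (m : X → ℝ) (e' : ℝ), Integrable m μ → ∫ w, m w ∂μ = e' → (∀ w, 0 ≤ m w) →
      (∀ w, m w ≤ p y w) → (∀ w, m w ≤ p z w) →
      ∫ w, g w * p y w ∂μ - ∫ w, g w * p z w ∂μ ≤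
        M * ((1 - e') + κ * (2 * C + dist y z / R)) := by
    intro m e' hm hme hm0 hmy hmz
    have h := integral_mul_sub_integral_mul_le_of_overlap (φ := fun w => M * κ / R * dist y w)
      (K₁ := M * κ / R * (C * R)) (K₂ := M * κ / R * (C * R + dist y z))
      (hpi y) (hpi z) hm (hp1 y) (hp1 z) hme hm0 hmy hmz hg hgb
      (fun w => by positivity) hoscφ
      (by simpa only [mul_assoc] using (hmoment_int y).const_mul (M * κ / R))
      (by simpa only [mul_assoc] using hyz_int.const_mul (M * κ / R))
      (by
        simp only [mul_assoc (M * κ / R), integral_const_mul]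
        have := hmoment y
        gcongr)
      (by
        simp only [mul_assoc (M * κ / R), integral_const_mul]
        gcongr)
    refine h.trans_eq ?_
    field_simp
    ring
  split_ifs with hd
  · have hfin : μ (closedBall y R) ≠ ⊤ := fun h => by
      rw [h, ENNReal.toReal_top] at hVy
      exact hV.ne hVy
    have hind : ∀ z', dist y z' ≤ R → ∀ w,
        (closedBall y R).indicator (fun _ => e / V) w ≤ p z' w := fun z' hz' w =>
      Set.indicator_le' (fun w hw => hlow z' hz' w hw) (fun w _ => hp0 z' w) w
    refine key ((closedBall y R).indicator fun _ => e / V) e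
      ((integrableOn_const hfin).integrable_indicator measurableSet_closedBall) ?_
      (Set.indicator_nonneg fun w _ => by positivity)
      (hind y (by simpa using hR.le)) (hind z hd)
    rw [integral_indicator_const _ measurableSet_closedBall, Measure.real, hVy, smul_eq_mul]
    field_simp
  · have := key (fun _ => 0) 0 (integrable_zero _ _ _) (by simp) (fun _ => le_rfl)
      (hp0 y) (hp0 z)
    simpa using this

/-- Contraction of oscillations by the heat semigroup, uniformly in the scale. -/
theorem exists_oscillation_contraction {X : Type*} [MetricSpace X] [MeasurableSpace X]
    [BorelSpace X] [Nonempty X] {μ : Measure X}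
    (hvol : ∀ (x : X) (r : ℝ), 0 < r → 0 < (μ (closedBall x r)).toReal)
    {D : ℝ} (hD : 0 < D)
    (hdouble : ∀ (x : X) (r : ℝ), 0 < r →
      (μ (closedBall x (2 * r))).toReal ≤ D * (μ (closedBall x r)).toReal)
    {T : ℝ → X → X → ℝ} {C₀ c₁ c₂ : ℝ} (hC₀ : 0 < C₀) (hc₂ : 0 < c₂) (hc₁₂ : c₂ ≤ c₁)
    (hgauss : ∀ (t : ℝ), 0 < t → ∀ x y : X,
      C₀⁻¹ / (μ (closedBall x (Real.sqrt t))).toReal *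
          Real.exp (-c₁ * dist x y ^ 2 / t) ≤ T t x y ∧
      T t x y ≤ C₀ / (μ (closedBall x (Real.sqrt t))).toReal *
          Real.exp (-c₂ * dist x y ^ 2 / t))
    (hconserv : ∀ (t : ℝ), 0 < t → ∀ x : X, ∫ y, T t x y ∂μ = 1) :
    ∃ κ > (0 : ℝ), ∃ θ > (0 : ℝ), θ < 1 ∧ ∃ r > (0 : ℝ), r ≤ 1 / 2 ∧
      ∀ R : ℝ, 0 < R → ∀ M : ℝ, 0 ≤ M → ∀ (g : X → ℝ) (b : ℝ), Measurable g →
      (∀ w, |g w| ≤ b) → (∀ w w', |g w - g w'| ≤ M * (1 + κ * (dist w w' / R))) →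
      ∀ y z, |∫ w, g w * T (R ^ 2) y w ∂μ - ∫ w, g w * T (R ^ 2) z w ∂μ| ≤
        M * θ * (1 + κ * (dist y z / (R * r))) := by
  have hT0 : ∀ t, 0 < t → ∀ x y, 0 ≤ T t x y := fun t ht x y => by
    have := hvol x _ (Real.sqrt_pos.2 ht)
    exact le_trans (by positivity) (hgauss t ht x y).1
  have hTi : ∀ t, 0 < t → ∀ x, Integrable (T t x) μ := fun t ht x =>
    integrable_of_integral_eq_one (hconserv t ht x)
  obtain ⟨K, hK, C, hC, hmom⟩ :=
    exists_dist_mul_kernel_le hvol hD hdouble hC₀ hc₂ hc₁₂ hgauss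
  obtain ⟨e, he, he1, hlow⟩ := exists_kernel_lower_bound hvol hD hdouble hC₀
    (hc₂.trans_le hc₁₂) (fun t ht x y => (hgauss t ht x y).1)
  set κ := e / (2 * (2 * C + 1)) with hκ
  have hκ0 : 0 < κ := by positivity
  have hκe : κ * (2 * C + 1) = e / 2 := by rw [hκ]; field_simp
  set θ := 1 - e / 2 with hθ
  have hθ0 : 0 < θ := by linarith
  set A := (1 + κ * (2 * C + 1)) / (θ * κ) + 2 with hA
  have hA2 : 2 ≤ A := by
    have : 0 ≤ (1 + κ * (2 * C + 1)) / (θ * κ) := by positivity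
    linarith
  have hA0 : 0 < A := by linarith
  have hθκA : 1 + κ * (2 * C + 1) ≤ θ * κ * A := by
    have : θ * κ * A = 1 + κ * (2 * C + 1) + 2 * (θ * κ) := by rw [hA]; field_simp
    have : 0 < θ * κ := by positivity
    linarith
  refine ⟨κ, hκ0, θ, hθ0, by linarith, 1 / A, by positivity,
    one_div_le_one_div_of_le two_pos hA2, fun R hR M hM g b hg hgb hosc => ?_⟩
  have hR2 : 0 < R ^ 2 := by positivity
  have hKR : 0 < K * R ^ 2 := by positivity
  have hmi : ∀ y, Integrable (fun w => dist y w * T (R ^ 2) y w) μ := fun y => by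
    refine ((hTi _ hKR y).const_mul (C * R)).mono'
      ((Continuous.measurable (by fun_prop)).aestronglyMeasurable.mul
        (hTi _ hR2 y).aestronglyMeasurable) (Filter.Eventually.of_forall fun w => ?_)
    rw [Real.norm_of_nonneg (mul_nonneg dist_nonneg (hT0 _ hR2 y w))]
    exact hmom R hR y w
  have hmC : ∀ y, ∫ w, dist y w * T (R ^ 2) y w ∂μ ≤ C * R := fun y =>
    calc _ ≤ ∫ w, C * R * T (K * R ^ 2) y w ∂μ :=
          integral_mono (hmi y) ((hTi _ hKR y).const_mul (C * R)) (hmom R hR y)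
      _ = C * R := by rw [integral_const_mul, hconserv _ hKR, mul_one]
  have main : ∀ y z, ∫ w, g w * T (R ^ 2) y w ∂μ - ∫ w, g w * T (R ^ 2) z w ∂μ ≤
      M * θ * (1 + κ * (dist y z / (R * (1 / A)))) := by
    intro y z
    refine (integral_mul_sub_integral_mul_le_of_scale hR (hvol y R hR) he.le hκ0.le hM
      (hT0 _ hR2) (hTi _ hR2) (hconserv _ hR2) hmi hmC hg hgb hosc rfl
      (fun z' hz' w hw => hlow R hR y z' w hz' hw)).trans ?_
    rw [mul_assoc M θ]
    gcongr
    have hξ : dist y z / (R * (1 / A)) = A * (dist y z / R) := by field_simp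
    rw [hξ]
    have hξ0 : 0 ≤ dist y z / R := by positivity
    split_ifs with hd
    · have hξ1 : dist y z / R ≤ 1 := (div_le_one hR).2 hd
      have h1 : κ * (2 * C + dist y z / R) ≤ κ * (2 * C + 1) := by gcongr
      have h2 : 0 ≤ θ * (κ * (A * (dist y z / R))) := by positivity
      linarith
    · have hξ1 : 1 ≤ dist y z / R := (one_le_div hR).2 (not_le.1 hd).le
      have h1 := mul_le_mul_of_nonneg_right hθκA hξ0
      have h2 : (1 + κ * (2 * C)) * 1 ≤ (1 + κ * (2 * C)) * (dist y z / R) := by gcongr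
      linarith
  intro y z
  rw [abs_sub_le_iff]
  exact ⟨main y z, by simpa only [dist_comm z y] using main z y⟩

/-- Iterating an oscillation contraction along a geometric sequence of scales. -/
theorem oscillation_kernel_le_pow {X : Type*} [MetricSpace X] [MeasurableSpace X]
    {μ : Measure X} {T : ℝ → X → X → ℝ}
    (hTmeas : ∀ t : ℝ, Measurable (Function.uncurry (T t)))
    (hTsymm : ∀ (t : ℝ), 0 < t → ∀ x y : X, T t x y = T t y x)
    (hTsemigroup : ∀ s t : ℝ, 0 < s → 0 < t → ∀ x y : X,
      T (s + t) x y = ∫ z, T s x z * T t z y ∂μ)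
    {κ θ r : ℝ} (hκ : 0 ≤ κ) (hθ : 0 ≤ θ) (hr : 0 < r)
    (hcontr : ∀ R : ℝ, 0 < R → ∀ M : ℝ, 0 ≤ M → ∀ (g : X → ℝ) (b : ℝ), Measurable g →
      (∀ w, |g w| ≤ b) → (∀ w w', |g w - g w'| ≤ M * (1 + κ * (dist w w' / R))) →
      ∀ y z, |∫ w, g w * T (R ^ 2) y w ∂μ - ∫ w, g w * T (R ^ 2) z w ∂μ| ≤
        M * θ * (1 + κ * (dist y z / (R * r))))
    {τ₀ R M : ℝ} (hτ₀ : 0 < τ₀) (hR : 0 < R) (hM : 0 ≤ M) {x : X}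
    (hT0 : ∀ τ, τ₀ ≤ τ → ∀ y, 0 ≤ T τ x y) (hTM : ∀ τ, τ₀ ≤ τ → ∀ y, T τ x y ≤ M) (n : ℕ) :
    ∀ τ, τ₀ + R ^ 2 * ∑ k ∈ Finset.range n, (r ^ 2) ^ k ≤ τ → ∀ y z,
      |T τ x y - T τ x z| ≤ M * θ ^ n * (1 + κ * (dist y z / (R * r ^ n))) := by
  induction n with
  | zero =>
    intro τ hτ y z
    have hτ' : τ₀ ≤ τ := by simpa using hτ
    have h1 : |T τ x y - T τ x z| ≤ M := abs_sub_le_iff.2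
      ⟨by linarith [hT0 τ hτ' z, hTM τ hτ' y], by linarith [hT0 τ hτ' y, hTM τ hτ' z]⟩
    have h2 : 0 ≤ M * (κ * (dist y z / R)) := by positivity
    simp only [pow_zero, mul_one]
    linarith
  | succ n ih =>
    intro τ hτ y z
    have hRn : 0 < R * r ^ n := by positivity
    have hRn2 : 0 < (R * r ^ n) ^ 2 := by positivity
    have hτn : τ₀ + R ^ 2 * ∑ k ∈ Finset.range n, (r ^ 2) ^ k ≤ τ - (R * r ^ n) ^ 2 := by
      rw [Finset.sum_range_succ] at hτ
      have : (R * r ^ n) ^ 2 = R ^ 2 * (r ^ 2) ^ n := by ring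
      rw [this]
      linarith
    have hτ' : τ₀ ≤ τ - (R * r ^ n) ^ 2 := by
      have : 0 ≤ R ^ 2 * ∑ k ∈ Finset.range n, (r ^ 2) ^ k := by positivity
      linarith
    have hrep : ∀ y, T τ x y =
        ∫ w, T (τ - (R * r ^ n) ^ 2) x w * T ((R * r ^ n) ^ 2) y w ∂μ := fun y => by
      have := hTsemigroup (τ - (R * r ^ n) ^ 2) _ (hτ₀.trans_le hτ') hRn2 x y
      rw [sub_add_cancel] at this
      simpa only [hTsymm _ hRn2 _ y] using this
    rw [hrep y, hrep z]
    refine (hcontr _ hRn (M * θ ^ n) (by positivity)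
      (T (τ - (R * r ^ n) ^ 2) x) M
      ((hTmeas _).comp measurable_prodMk_left)
      (fun w => by rw [abs_of_nonneg (hT0 _ hτ' w)]; exact hTM _ hτ' w)
      (ih _ hτn) y z).trans_eq ?_
    ring_nf

theorem exists_pow_le_mul_rpow {θ r : ℝ} (hθ : 0 < θ) (hθ1 : θ < 1) (hr : 0 < r) (hr1 : r < 1) :
    ∃ β > (0 : ℝ), ∀ ρ : ℝ, 0 < ρ → ρ ≤ 1 → ∃ n : ℕ, ρ ≤ r ^ n ∧ θ ^ n ≤ θ⁻¹ * ρ ^ β := by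
  have hlog : Real.log r < 0 := Real.log_neg hr hr1
  refine ⟨Real.log θ / Real.log r, div_pos_of_neg_of_neg (Real.log_neg hθ hθ1) hlog,
    fun ρ hρ hρ1 => ?_⟩
  obtain ⟨n, hn, hn'⟩ := exists_nat_pow_near_of_lt_one hρ hρ1 hr hr1
  refine ⟨n, hn', ?_⟩
  have hrθ : r ^ (Real.log θ / Real.log r) = θ := by
    rw [Real.rpow_def_of_pos hr, mul_div_cancel₀ _ hlog.ne, Real.exp_log hθ]
  have hβ : 0 ≤ Real.log θ / Real.log r :=
    (div_pos_of_neg_of_neg (Real.log_neg hθ hθ1) hlog).le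
  calc θ ^ n = θ⁻¹ * θ ^ (n + 1) := by rw [pow_succ']; field_simp
    _ = θ⁻¹ * (r ^ (n + 1)) ^ (Real.log θ / Real.log r) := by
        rw [← Real.rpow_natCast, ← Real.rpow_natCast, ← Real.rpow_mul hr.le,
          mul_comm ((n + 1 : ℕ) : ℝ), Real.rpow_mul hr.le, hrθ]
    _ ≤ _ := by gcongr

/-- Hölder-type estimate for a conservative heat kernel with two-sided Gaussian
bounds: `|T_t(x,y) − T_t(x,z)| ≤ C μ(B(x,√t))⁻¹ (d(y,z)/√t)^α exp(−c d(x,y)²/t)`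
whenever `d(y,z) ≤ √t`. -/
theorem heat_kernel_holder_estimate
    {X : Type*} [MetricSpace X] [MeasurableSpace X] [BorelSpace X]
    (μ : Measure X)
    (hvol : ∀ (x : X) (r : ℝ), 0 < r → 0 < (μ (closedBall x r)).toReal)
    (Cdbl : ℝ) (hCdbl : 0 < Cdbl)
    (hdouble : ∀ (x : X) (r : ℝ), 0 < r →
      (μ (closedBall x (2 * r))).toReal ≤ Cdbl * (μ (closedBall x r)).toReal)
    (T : ℝ → X → X → ℝ)
    (hTmeas : ∀ t : ℝ, Measurable (Function.uncurry (T t)))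
    (hTsymm : ∀ (t : ℝ), 0 < t → ∀ x y : X, T t x y = T t y x)
    (hTsemigroup : ∀ s t : ℝ, 0 < s → 0 < t → ∀ x y : X,
      T (s + t) x y = ∫ z, T s x z * T t z y ∂μ)
    (C₀ c₁ c₂ : ℝ) (hC₀ : 0 < C₀) (hc₂ : 0 < c₂) (hc₁₂ : c₂ ≤ c₁)
    (hgauss : ∀ (t : ℝ), 0 < t → ∀ x y : X,
      C₀⁻¹ / (μ (closedBall x (Real.sqrt t))).toReal *
          Real.exp (-c₁ * dist x y ^ 2 / t) ≤ T t x y ∧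
      T t x y ≤ C₀ / (μ (closedBall x (Real.sqrt t))).toReal *
          Real.exp (-c₂ * dist x y ^ 2 / t))
    (hconserv : ∀ (t : ℝ), 0 < t → ∀ x : X, ∫ y, T t x y ∂μ = 1) :
    ∃ α > (0 : ℝ), ∃ c > (0 : ℝ), ∃ C > (0 : ℝ), ∀ (t : ℝ), 0 < t →
      ∀ x y z : X, dist y z ≤ Real.sqrt t →
      |T t x y - T t x z| ≤
        C * (μ (closedBall x (Real.sqrt t))).toReal⁻¹ *
          (dist y z / Real.sqrt t) ^ α * Real.exp (-c * dist x y ^ 2 / t) := by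
  rcases isEmpty_or_nonempty X with hX | hX
  · exact ⟨1, one_pos, 1, one_pos, 1, one_pos, fun _ _ x => isEmptyElim x⟩
  obtain ⟨κ, hκ, θ, hθ, hθ1, r, hr, hr2, hcontr⟩ := exists_oscillation_contraction hvol hCdbl
    hdouble hC₀ hc₂ hc₁₂ hgauss hconserv
  obtain ⟨β, hβ, hpow⟩ := exists_pow_le_mul_rpow hθ hθ1 hr (hr2.trans_lt (by norm_num))
  set K₁ := C₀ * Cdbl * θ⁻¹ * (1 + κ * 2) with hK₁
  set K₂ := C₀ * Real.exp c₂ with hK₂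
  have hK₁0 : 0 < K₁ := by positivity
  have hK₂0 : 0 < K₂ := by positivity
  refine ⟨β / 2, by positivity, c₂ / 4, by positivity, Real.sqrt (K₁ * K₂), by positivity,
    fun t ht x y z hyz => ?_⟩
  have hst : 0 < Real.sqrt t := Real.sqrt_pos.2 ht
  have hT0 : ∀ τ, 0 < τ → ∀ y, 0 ≤ T τ x y := fun τ hτ y => by
    have := hvol x _ (Real.sqrt_pos.2 hτ)
    exact le_trans (by positivity) (hgauss τ hτ x y).1
  rcases eq_or_ne y z with rfl | hne
  · rw [sub_self, abs_zero]
    positivity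
  set V := (μ (closedBall x (Real.sqrt t))).toReal with hV
  have hV0 : 0 < V := hvol x _ hst
  set ρ := dist y z / Real.sqrt t with hρ
  have hρ0 : 0 < ρ := div_pos (dist_pos.2 hne) hst
  -- Hölder bound without Gaussian decay
  have ha : |T t x y - T t x z| ≤ K₁ * V⁻¹ * ρ ^ β := by
    obtain ⟨n, hn, hθn⟩ := hpow ρ hρ0 ((div_le_one hst).2 hyz)
    have hM : ∀ τ, t / 2 ≤ τ → ∀ y, T τ x y ≤ C₀ * Cdbl / V := fun τ hτ y => by
      have hτ0 : 0 < τ := by linarith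
      have hVτ := hvol x _ (Real.sqrt_pos.2 hτ0)
      have hsqrt : Real.sqrt t ≤ 2 * Real.sqrt τ := by
        rw [Real.sqrt_le_left (by positivity), mul_pow, Real.sq_sqrt hτ0.le]
        linarith
      have hVV : V ≤ Cdbl * (μ (closedBall x (Real.sqrt τ))).toReal :=
        (measure_closedBall_toReal_mono hvol (by positivity)
          (closedBall_subset_closedBall hsqrt)).trans (hdouble x _ (Real.sqrt_pos.2 hτ0))
      have hexp : Real.exp (-c₂ * dist x y ^ 2 / τ) ≤ 1 := by
        rw [Real.exp_le_one_iff, neg_mul, neg_div, neg_nonpos]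
        positivity
      calc T τ x y ≤ _ := (hgauss τ hτ0 x y).2
        _ ≤ C₀ / (μ (closedBall x (Real.sqrt τ))).toReal * 1 := by gcongr
        _ = C₀ * Cdbl / (Cdbl * (μ (closedBall x (Real.sqrt τ))).toReal) := by field_simp
        _ ≤ _ := by gcongr
    have hsum : t / 2 + (Real.sqrt t / 2) ^ 2 * ∑ k ∈ Finset.range n, (r ^ 2) ^ k ≤ t := by
      have h1 : ∑ k ∈ Finset.range n, (r ^ 2) ^ k ≤ 2 := by
        refine le_trans (Finset.sum_le_sum fun k _ => ?_) (sum_geometric_two_le n)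
        gcongr
        nlinarith
      rw [div_pow, Real.sq_sqrt ht.le]
      nlinarith
    have h := oscillation_kernel_le_pow hTmeas hTsymm hTsemigroup hκ.le hθ.le hr hcontr
      (half_pos ht) (half_pos hst) (by positivity : 0 ≤ C₀ * Cdbl / V)
      (fun τ hτ => hT0 τ (by linarith)) hM n t hsum y z
    have hd : dist y z / (Real.sqrt t / 2 * r ^ n) ≤ 2 := by
      have : dist y z = ρ * Real.sqrt t := by rw [hρ]; field_simp
      rw [div_le_iff₀ (by positivity), this]
      nlinarith
    calc _ ≤ _ := h
      _ ≤ C₀ * Cdbl / V * (θ⁻¹ * ρ ^ β) * (1 + κ * 2) := by gcongr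
      _ = _ := by rw [hK₁]; ring
  -- Gaussian bound without Hölder decay
  have hb : |T t x y - T t x z| ≤ K₂ * V⁻¹ * Real.exp (-(c₂ / 2) * dist x y ^ 2 / t) := by
    have hz : ∀ w, dist y w ≤ Real.sqrt t →
        T t x w ≤ K₂ * V⁻¹ * Real.exp (-(c₂ / 2) * dist x y ^ 2 / t) := fun w hw => by
      have h1 : dist x y ≤ dist x w + dist y w := dist_triangle_right x y w
      have h2 : dist y w ^ 2 ≤ t := by
        rw [← Real.sq_sqrt ht.le]
        gcongr
      have h3 : dist x y ^ 2 ≤ 2 * dist x w ^ 2 + 2 * t := by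
        have : dist x y ^ 2 ≤ (dist x w + dist y w) ^ 2 := by gcongr
        nlinarith [sq_nonneg (dist x w - dist y w)]
      have h4 : -c₂ * dist x w ^ 2 / t ≤ c₂ + -(c₂ / 2) * dist x y ^ 2 / t := by
        have : c₂ + -(c₂ / 2) * dist x y ^ 2 / t = (c₂ * t + -(c₂ / 2) * dist x y ^ 2) / t := by
          field_simp
        rw [this, div_le_div_iff_of_pos_right ht]
        nlinarith
      calc T t x w ≤ C₀ / V * Real.exp (-c₂ * dist x w ^ 2 / t) := (hgauss t ht x w).2
        _ ≤ C₀ / V * Real.exp (c₂ + -(c₂ / 2) * dist x y ^ 2 / t) := by gcongr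
        _ = _ := by rw [Real.exp_add, hK₂]; ring
    exact abs_sub_le_iff.2
      ⟨by linarith [hT0 t ht z, hz y (by simp)], by linarith [hT0 t ht y, hz z hyz]⟩
  refine abs_le_of_sq_le_sq ?_ (by positivity)
  rw [← sq_abs]
  calc |T t x y - T t x z| ^ 2
      ≤ (K₁ * V⁻¹ * ρ ^ β) * (K₂ * V⁻¹ * Real.exp (-(c₂ / 2) * dist x y ^ 2 / t)) := by
        rw [sq]
        gcongr
    _ = (Real.sqrt (K₁ * K₂) * V⁻¹ * ρ ^ (β / 2) *
          Real.exp (-(c₂ / 4) * dist x y ^ 2 / t)) ^ 2 := by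
        rw [mul_pow, mul_pow, mul_pow, Real.sq_sqrt (by positivity), ← Real.rpow_mul_natCast hρ0.le,
          ← Real.exp_nat_mul]
        push_cast
        rw [div_mul_cancel₀ _ two_ne_zero]
        ring_nf
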